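/- arXiv:1506.08738 — 2 statements merged into one kernel-verified Lean document; each statement's English description precedes it below -/
import Mathlib

section
/- Let X be a Noetherian integral scheme. Then X is N-1 (its normalization is finite over X) if and only if X is punctually N-1 (the punctual normalization at every point is finite) and there are only finitely many points x ∈ X such that (x, X) is not punctually normal. -/
set_option synthInstance.maxHeartbeats 1000000
set_option maxHeartbeats 2000000

/-- The punctual normalization of the local ring A (the subring of elements of the total
fraction ring that are integral over A and regular away from the closed point, i.e. lie
in A_q for all primes q ≠ m) is a finite A-module: it is contained in some finite
subalgebra of the total fraction ring. -/
def PunctuallyN1 (A : Type) [CommRing A] [IsLocalRing A] : Prop :=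
  ∃ B : Subalgebra A (FractionRing A), Module.Finite A B ∧
    ∀ x : FractionRing A, IsIntegral A x →
      (∀ q : PrimeSpectrum A, q.asIdeal ≠ IsLocalRing.maximalIdeal A →
        ∃ a : A, ∃ s ∈ q.asIdeal.primeCompl,
          x * algebraMap A (FractionRing A) s = algebraMap A (FractionRing A) a) →
      x ∈ B

/-- The local ring A is punctually normal: every element of its punctual normalization
already lies in A. -/
def PunctuallyNormal (A : Type) [CommRing A] [IsLocalRing A] : Prop :=
  ∀ x : FractionRing A, IsIntegral A x →
    (∀ q : PrimeSpectrum A, q.asIdeal ≠ IsLocalRing.maximalIdeal A →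
      ∃ a : A, ∃ s ∈ q.asIdeal.primeCompl,
        x * algebraMap A (FractionRing A) s = algebraMap A (FractionRing A) a) →
    x ∈ (algebraMap A (FractionRing A)).range

/-- The ideal of all `r : R` with `r • x ∈ R`, for `x` in an `R`-algebra `K`. -/
def denominatorIdeal (R : Type*) {K : Type*} [CommRing R] [CommRing K] [Algebra R K] (x : K) :
    Ideal R :=
  (1 : Submodule R K).colon {x}

section Denominators

variable {R K : Type*} [CommRing R]

theorem mem_denominatorIdeal [CommRing K] [Algebra R K] {x : K} {r : R} :
    r ∈ denominatorIdeal R x ↔ ∃ a : R, algebraMap R K a = r • x := by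
  rw [denominatorIdeal, Submodule.mem_colon_singleton, Submodule.mem_one]

theorem denominatorIdeal_le_smul [CommRing K] [Algebra R K] (c : R) (x : K) :
    denominatorIdeal R x ≤ denominatorIdeal R (c • x) := by
  intro r hr
  obtain ⟨a, ha⟩ := mem_denominatorIdeal.1 hr
  exact mem_denominatorIdeal.2 ⟨c * a, by rw [map_mul, ha, smul_comm, Algebra.smul_def c]⟩

theorem denominatorIdeal_smul_le_iff [CommRing K] [Algebra R K] {s : R} {x : K} {q : Ideal R}
    [hq : q.IsPrime] (hs : s ∉ q) :
    denominatorIdeal R (s • x) ≤ q ↔ denominatorIdeal R x ≤ q := by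
  refine ⟨(denominatorIdeal_le_smul s x).trans, fun h r hr ↦ ?_⟩
  obtain ⟨a, ha⟩ := mem_denominatorIdeal.1 hr
  refine (hq.mem_or_mem (h (mem_denominatorIdeal.2 ⟨a, ?_⟩) : r * s ∈ q)).resolve_right hs
  rw [ha, mul_smul]

theorem mem_range_of_forall_not_denominatorIdeal_le [CommRing K] [Algebra R K] {x : K}
    (h : ∀ p : PrimeSpectrum R, ¬ denominatorIdeal R x ≤ p.asIdeal) :
    ∃ a : R, algebraMap R K a = x := by
  have htop : denominatorIdeal R x = ⊤ := by
    by_contra hne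
    obtain ⟨m, hm, hle⟩ := Ideal.exists_le_maximal _ hne
    exact h ⟨m, hm.isPrime⟩ hle
  obtain ⟨a, ha⟩ := mem_denominatorIdeal.1 (htop ▸ Submodule.mem_top : (1 : R) ∈ _)
  exact ⟨a, by rw [ha, one_smul]⟩

/-- Only finitely many primes are minimal over the denominator ideal of an element of
`c⁻¹ R`: they are associated primes of `R ⧸ (c)`. -/
theorem finite_minimalPrimes_denominatorIdeal [IsNoetherianRing R] [Field K] [Algebra R K]
    [FaithfulSMul R K] {c : R} (hc : c ≠ 0) :
    {p : PrimeSpectrum R | ∃ x : K, (∃ b : R, algebraMap R K b = c • x) ∧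
      p.asIdeal ∈ (denominatorIdeal R x).minimalPrimes}.Finite := by
  refine Set.Finite.of_finite_image (f := PrimeSpectrum.asIdeal)
    ((associatedPrimes.finite R (R ⧸ Ideal.span {c})).subset ?_)
    (fun _ _ _ _ h ↦ PrimeSpectrum.ext h)
  rintro _ ⟨p, ⟨x, ⟨b, hb⟩, hp⟩, rfl⟩
  have hinj := FaithfulSMul.algebraMap_injective R K
  have hcK : algebraMap R K c ≠ 0 := (map_ne_zero_iff _ hinj).2 hc
  have hD : denominatorIdeal R x = (⊥ : Submodule R (R ⧸ Ideal.span {c})).colon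
      {Ideal.Quotient.mk (Ideal.span {c}) b} := by
    ext r
    rw [mem_denominatorIdeal, Submodule.mem_colon_singleton, Submodule.mem_bot,
      Algebra.smul_def r (Ideal.Quotient.mk (Ideal.span {c}) b),
      Ideal.Quotient.algebraMap_eq, ← map_mul, Ideal.Quotient.eq_zero_iff_mem,
      Ideal.mem_span_singleton]
    refine exists_congr fun a ↦ ?_
    rw [← hinj.eq_iff, map_mul, map_mul, hb, mul_comm, ← mul_right_inj' hcK,
      Algebra.smul_def, Algebra.smul_def]
    constructor <;> intro h <;> linear_combination -h
  rw [hD] at hp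
  exact isAssociatedPrime_iff.2 ⟨p.2, Submodule.exists_eq_colon_of_mem_minimalPrimes hp⟩

/-- A submodule of the fraction field of a Noetherian domain is finite if and only if
its elements have a common denominator. -/
theorem finite_iff_exists_common_denominator [IsDomain R] [IsNoetherianRing R] [Field K]
    [Algebra R K] [IsFractionRing R K] (N : Submodule R K) :
    Module.Finite R N ↔ ∃ c : R, c ≠ 0 ∧ ∀ x ∈ N, ∃ a : R, algebraMap R K a = c • x := by
  constructor
  · intro h
    obtain ⟨S, hS⟩ := Module.Finite.iff_fg.1 h
    obtain ⟨c, hc⟩ := IsLocalization.exist_integer_multiples_of_finset (nonZeroDivisors R) S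
    refine ⟨c, nonZeroDivisors.coe_ne_zero c, fun x hx ↦ ?_⟩
    rw [← hS] at hx
    have hle : Submodule.span R (S : Set K) ≤
        (1 : Submodule R K).comap (LinearMap.lsmul R K (c : R)) :=
      Submodule.span_le.2 fun y hy ↦ by
        obtain ⟨a, ha⟩ := hc y hy
        exact Submodule.mem_one.2 ⟨a, ha⟩
    exact Submodule.mem_one.1 (hle hx)
  · rintro ⟨c, hc, h⟩
    have hle : N.map (LinearMap.lsmul R K c) ≤ 1 := by
      rintro _ ⟨x, hx, rfl⟩
      exact Submodule.mem_one.2 (h x hx)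
    have hfg : (N.map (LinearMap.lsmul R K c)).FG := by
      have : IsNoetherian R (1 : Submodule R K) := by
        rw [Submodule.one_eq_range]
        infer_instance
      exact (IsNoetherian.noetherian (Submodule.comap (1 : Submodule R K).subtype _)).map
        (1 : Submodule R K).subtype |> fun h' ↦ by
          rwa [Submodule.map_comap_subtype, inf_eq_right.2 hle] at h'
    refine Module.Finite.iff_fg.2 (Submodule.fg_of_fg_map_injective _ (fun x y hxy ↦ ?_) hfg)
    have hxy' : c • x = c • y := hxy
    exact smul_right_injective K hc hxy'

end Denominators

section LocalRing

variable {A : Type} [CommRing A] [IsLocalRing A]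

/-- `x` is integral over the local ring `A` and regular away from the closed point. -/
def IsPunctuallyIntegral (A : Type*) {K : Type*} [CommRing A] [IsLocalRing A] [CommRing K]
    [Algebra A K] (x : K) : Prop :=
  IsIntegral A x ∧ ∀ q : PrimeSpectrum A, q.asIdeal ≠ IsLocalRing.maximalIdeal A →
    ¬ denominatorIdeal A x ≤ q.asIdeal

theorem not_denominatorIdeal_le_iff {R K : Type*} [CommRing R] [CommRing K] [Algebra R K]
    {x : K} {q : Ideal R} [q.IsPrime] :
    ¬ denominatorIdeal R x ≤ q ↔
      ∃ a : R, ∃ s ∈ q.primeCompl, x * algebraMap R K s = algebraMap R K a := by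
  simp only [SetLike.not_le_iff_exists, mem_denominatorIdeal, Algebra.smul_def]
  constructor
  · rintro ⟨s, ⟨a, ha⟩, hs⟩
    exact ⟨a, s, hs, by rw [ha, mul_comm]⟩
  · rintro ⟨a, s, hs, h⟩
    exact ⟨s, ⟨a, by rw [← h, mul_comm]⟩, hs⟩

theorem isPunctuallyIntegral_algEquiv_iff {K L : Type*} [CommRing K] [CommRing L] [Algebra A K]
    [Algebra A L] (e : K ≃ₐ[A] L) {x : K} :
    IsPunctuallyIntegral A (e x) ↔ IsPunctuallyIntegral A x := by
  have hD : denominatorIdeal A (e x) = denominatorIdeal A x := by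
    ext r
    simp only [mem_denominatorIdeal, ← map_smul, ← e.commutes, e.injective.eq_iff]
  rw [IsPunctuallyIntegral, IsPunctuallyIntegral, hD, isIntegral_algEquiv]

theorem punctuallyNormal_iff (K : Type*) [Field K] [Algebra A K] [IsFractionRing A K] :
    PunctuallyNormal A ↔
      ∀ x : K, IsPunctuallyIntegral A x → ∃ a : A, algebraMap A K a = x := by
  let e := FractionRing.algEquiv A K
  have h : PunctuallyNormal A ↔ ∀ x : FractionRing A, IsPunctuallyIntegral A x →
      ∃ a : A, algebraMap A (FractionRing A) a = x := by
    simp only [PunctuallyNormal, IsPunctuallyIntegral, not_denominatorIdeal_le_iff, and_imp,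
      RingHom.mem_range]
  rw [h, e.toEquiv.forall_congr_left]
  refine forall_congr' fun x ↦ imp_congr ?_ ?_
  · exact isPunctuallyIntegral_algEquiv_iff e.symm
  · refine exists_congr fun a ↦ ?_
    rw [← e.injective.eq_iff, e.commutes]
    simp

theorem punctuallyN1_iff (K : Type*) [Field K] [Algebra A K]
    [IsFractionRing A K] :
    PunctuallyN1 A ↔ ∃ B : Subalgebra A K, Module.Finite A B ∧
      ∀ x : K, IsPunctuallyIntegral A x → x ∈ B := by
  let e := FractionRing.algEquiv A K
  have h : PunctuallyN1 A ↔ ∃ B : Subalgebra A (FractionRing A), Module.Finite A B ∧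
      ∀ x : FractionRing A, IsPunctuallyIntegral A x → x ∈ B := by
    simp only [PunctuallyN1, IsPunctuallyIntegral, not_denominatorIdeal_le_iff, and_imp]
  rw [h]
  constructor
  · rintro ⟨B, hB, hx⟩
    refine ⟨B.map e.toAlgHom, Module.Finite.equiv (e.subalgebraMap B).toLinearEquiv,
      fun x hxi ↦ ⟨e.symm x, hx _ ((isPunctuallyIntegral_algEquiv_iff e.symm).2 hxi), ?_⟩⟩
    simp
  · rintro ⟨B, hB, hx⟩
    refine ⟨B.map e.symm.toAlgHom, Module.Finite.equiv (e.symm.subalgebraMap B).toLinearEquiv,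
      fun x hxi ↦ ⟨e x, hx _ ((isPunctuallyIntegral_algEquiv_iff e).2 hxi), ?_⟩⟩
    simp

end LocalRing

section AtPrime

variable {R K : Type*} [CommRing R] [Field K] [Algebra R K]
  (p : Ideal R) [p.IsPrime] (A : Type*) [CommRing A] [Algebra R A] [IsLocalization.AtPrime A p]
  [Algebra A K] [IsScalarTower R A K]

/-- The denominators of `x` over `R_p` are generated by the denominators over `R`. -/
theorem mem_denominatorIdeal_localization_iff {x : K} {r : R} :
    algebraMap R A r ∈ denominatorIdeal A x ↔
      ∃ t ∉ p, t * r ∈ denominatorIdeal R x := by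
  simp only [mem_denominatorIdeal]
  constructor
  · rintro ⟨a, ha⟩
    obtain ⟨⟨b, t⟩, hb⟩ := IsLocalization.surj p.primeCompl a
    refine ⟨t, t.2, b, ?_⟩
    rw [IsScalarTower.algebraMap_apply R A K, ← hb, map_mul, ha, mul_smul, algebraMap_smul,
      ← IsScalarTower.algebraMap_apply, Algebra.smul_def (t : R), mul_comm]
  · rintro ⟨t, ht, b, hb⟩
    lift t to p.primeCompl using ht
    refine ⟨IsLocalization.mk' A b t, ?_⟩
    have hu : IsUnit (algebraMap A K (algebraMap R A t)) :=
      (IsLocalization.map_units A t).map _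
    refine hu.mul_left_cancel ?_
    rw [← map_mul, IsLocalization.mk'_spec', ← IsScalarTower.algebraMap_apply, hb, mul_smul,
      ← IsScalarTower.algebraMap_apply, algebraMap_smul, ← Algebra.smul_def]

theorem denominatorIdeal_localization_le_iff {R K : Type*} [CommRing R] [Field K] [Algebra R K]
    (p : Ideal R) [p.IsPrime] (A : Type*) [CommRing A] [Algebra R A]
    [IsLocalization.AtPrime A p] [Algebra A K] [IsScalarTower R A K] {x : K}
    (q : Ideal A) [q.IsPrime] :
    denominatorIdeal A x ≤ q ↔ denominatorIdeal R x ≤ q.under R := by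
  have hqp : q.under R ≤ p :=
    (IsLocalization.AtPrime.orderIsoOfPrime A p ⟨q, inferInstance⟩).2.2
  constructor
  · intro h r hr
    refine h ((mem_denominatorIdeal_localization_iff p A).2 ⟨1, p.primeCompl.one_mem, ?_⟩)
    rwa [one_mul]
  · intro h y hy
    obtain ⟨⟨r, s⟩, hrs⟩ := IsLocalization.surj p.primeCompl y
    have hr : algebraMap R A r ∈ denominatorIdeal A x := hrs ▸ Ideal.mul_mem_right _ _ hy
    obtain ⟨t, ht, htr⟩ := (mem_denominatorIdeal_localization_iff p A).1 hr
    have hr' : r ∈ q.under R :=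
      ((inferInstance : (q.under R).IsPrime).mem_or_mem (h htr)).resolve_left (ht <| hqp ·)
    have hy' : y * algebraMap R A s ∈ q := hrs ▸ hr'
    refine ((inferInstance : q.IsPrime).mem_or_mem hy').resolve_right fun hs ↦ ?_
    exact s.2 (hqp hs)

theorem exists_algebraMap_localization_eq_iff {x : K} :
    (∃ a : A, algebraMap A K a = x) ↔ ¬ denominatorIdeal R x ≤ p := by
  have h := mem_denominatorIdeal_localization_iff p A (x := x) (r := 1)
  rw [map_one, mem_denominatorIdeal, one_smul] at h
  simp only [h, mul_one, SetLike.not_le_iff_exists, and_comm]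

theorem isPunctuallyIntegral_localization_iff [IsLocalRing A] {x : K} (hx : IsIntegral R x) :
    IsPunctuallyIntegral A x ↔ ∀ q : Ideal R, q.IsPrime → q < p → ¬ denominatorIdeal R x ≤ q := by
  let e := IsLocalization.AtPrime.orderIsoOfPrime A p
  have hm : (IsLocalRing.maximalIdeal A).under R = p :=
    IsLocalization.AtPrime.under_maximalIdeal A p
  rw [IsPunctuallyIntegral, and_iff_right hx.tower_top]
  constructor
  · intro h q hq hqp
    have hq' : (e.symm ⟨q, hq, hqp.le⟩).1.under R = q :=
      congrArg Subtype.val (e.apply_symm_apply ⟨q, hq, hqp.le⟩)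
    have := (e.symm ⟨q, hq, hqp.le⟩).2
    rw [← hq', ← denominatorIdeal_localization_le_iff p A]
    refine h ⟨_, this⟩ fun hmax ↦ hqp.ne ?_
    exact hq'.symm.trans ((congrArg (Ideal.under R) hmax).trans hm)
  · intro h q hne
    rw [denominatorIdeal_localization_le_iff p A]
    refine h _ inferInstance (lt_of_le_of_ne (e ⟨q.asIdeal, q.2⟩).2.2 fun heq ↦ hne ?_)
    have := e.injective (a₁ := ⟨q.asIdeal, q.2⟩)
      (a₂ := ⟨IsLocalRing.maximalIdeal A, inferInstance⟩) (Subtype.ext (heq.trans hm.symm))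
    exact congrArg Subtype.val this

theorem IsPunctuallyIntegral.exists_smul [IsLocalRing A] {x : K}
    (hx : IsPunctuallyIntegral A x) :
    ∃ s ∉ p, IsIntegral R (s • x) ∧ IsPunctuallyIntegral A (s • x) := by
  obtain ⟨s, hs⟩ := hx.1.exists_multiple_integral_of_isLocalization p.primeCompl x
  refine ⟨s, s.2, hs, hs.tower_top, fun q hq hle ↦ hx.2 q hq (le_trans ?_ hle)⟩
  have := denominatorIdeal_le_smul (algebraMap R A s) x
  rwa [algebraMap_smul] at this

end AtPrime

section Domain

variable {R : Type} [CommRing R] [IsDomain R]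

theorem punctuallyNormal_localization_iff (p : PrimeSpectrum R) :
    PunctuallyNormal (Localization.AtPrime p.asIdeal) ↔
      ∀ x : FractionRing R, IsIntegral R x →
        p.asIdeal ∉ (denominatorIdeal R x).minimalPrimes := by
  rw [punctuallyNormal_iff (FractionRing R)]
  have key : ∀ x : FractionRing R, IsIntegral R x →
      (p.asIdeal ∈ (denominatorIdeal R x).minimalPrimes ↔
        IsPunctuallyIntegral (Localization.AtPrime p.asIdeal) x ∧
          ¬ ∃ a, algebraMap (Localization.AtPrime p.asIdeal) (FractionRing R) a = x) := by
    intro x hx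
    rw [isPunctuallyIntegral_localization_iff p.asIdeal _ hx,
      exists_algebraMap_localization_eq_iff p.asIdeal, not_not]
    constructor
    · intro h
      exact ⟨fun q hq hqp hle ↦ hqp.not_ge (h.2 ⟨hq, hle⟩ hqp.le), h.1.2⟩
    · rintro ⟨h, hle⟩
      refine ⟨⟨p.2, hle⟩, fun q hq hqp ↦ ?_⟩
      by_contra hne
      exact h q hq.1 (lt_of_le_not_ge hqp hne) hq.2
  constructor
  · intro h x hx hmin
    obtain ⟨h1, h2⟩ := (key x hx).1 hmin
    exact h2 (h x h1)
  · intro h x hx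
    obtain ⟨s, hs, hsi, hsp⟩ := hx.exists_smul p.asIdeal
    have := h _ hsi
    rw [key _ hsi] at this
    have h2 := not_not.1 fun hn ↦ this ⟨hsp, hn⟩
    rw [exists_algebraMap_localization_eq_iff p.asIdeal] at h2 ⊢
    rwa [denominatorIdeal_smul_le_iff hs] at h2

theorem exists_not_punctuallyNormal_le {x : FractionRing R} (hx : IsIntegral R x)
    {p : PrimeSpectrum R} (hp : denominatorIdeal R x ≤ p.asIdeal) :
    ∃ q ≤ p, ¬ PunctuallyNormal (Localization.AtPrime q.asIdeal) ∧
      denominatorIdeal R x ≤ q.asIdeal := by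
  obtain ⟨q, hq, hqp⟩ := Ideal.exists_minimalPrimes_le hp
  refine ⟨⟨q, hq.1.1⟩, hqp, fun h ↦ ?_, hq.1.2⟩
  exact (punctuallyNormal_localization_iff _).1 h x hx hq

/-- A common denominator at finitely many primes can be found by multiplying. -/
theorem exists_smul_of_finite {S : Set (PrimeSpectrum R)} (hS : S.Finite)
    (h : ∀ q ∈ S, ∃ c : R, c ≠ 0 ∧ ∀ x : FractionRing R, IsIntegral R x →
      ¬ denominatorIdeal R (c • x) ≤ q.asIdeal) :
    ∃ c : R, c ≠ 0 ∧ ∀ x : FractionRing R, IsIntegral R x →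
      ∀ q ∈ S, ¬ denominatorIdeal R (c • x) ≤ q.asIdeal := by
  induction S, hS using Set.Finite.induction_on with
  | empty => exact ⟨1, one_ne_zero, by simp⟩
  | @insert p S _ _ ih =>
    obtain ⟨c, hc, hcx⟩ := ih fun q hq ↦ h q (Set.mem_insert_of_mem _ hq)
    obtain ⟨d, hd, hdx⟩ := h p (Set.mem_insert _ _)
    refine ⟨c * d, mul_ne_zero hc hd, fun x hx q hq hle ↦ ?_⟩
    rcases hq with rfl | hq
    · rw [mul_smul] at hle
      exact hdx x hx ((denominatorIdeal_le_smul c _).trans hle)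
    · rw [mul_comm, mul_smul] at hle
      exact hcx x hx q hq ((denominatorIdeal_le_smul d _).trans hle)

variable [IsNoetherianRing R]

/-- If `R_p` is punctually N-1, its punctual normalization has a common denominator in `R`. -/
theorem PunctuallyN1.exists_smul {p : PrimeSpectrum R}
    (h : PunctuallyN1 (Localization.AtPrime p.asIdeal)) :
    ∃ c : R, c ≠ 0 ∧ ∀ x : FractionRing R, IsIntegral R x →
      (∀ q < p, ¬ denominatorIdeal R x ≤ q.asIdeal) →
        ¬ denominatorIdeal R (c • x) ≤ p.asIdeal := by
  have : IsNoetherianRing (Localization.AtPrime p.asIdeal) :=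
    IsLocalization.isNoetherianRing p.asIdeal.primeCompl _ inferInstance
  obtain ⟨B, hB, hmem⟩ := (punctuallyN1_iff (FractionRing R)).1 h
  obtain ⟨d, hd, hdB⟩ := (finite_iff_exists_common_denominator B.toSubmodule).1 hB
  obtain ⟨⟨c, s⟩, hcs⟩ := IsLocalization.surj p.asIdeal.primeCompl d
  refine ⟨c, ?_, fun x hx hreg ↦ ?_⟩
  · rintro rfl
    rw [map_zero] at hcs
    exact hd ((IsLocalization.map_units _ s).mul_left_eq_zero.1 hcs)
  · rw [← exists_algebraMap_localization_eq_iff p.asIdeal (Localization.AtPrime p.asIdeal)]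
    obtain ⟨a, ha⟩ := hdB x (hmem x
      ((isPunctuallyIntegral_localization_iff p.asIdeal _ hx).2 fun q hq hqp ↦ hreg ⟨q, hq⟩ hqp))
    refine ⟨a * algebraMap R _ s, ?_⟩
    rw [map_mul, ha, ← algebraMap_smul (Localization.AtPrime p.asIdeal) c x, ← hcs, mul_comm d,
      mul_smul, Algebra.smul_def (algebraMap R (Localization.AtPrime p.asIdeal) s), mul_comm]

end Domain

/-- A Noetherian integral (affine) scheme Spec R is N-1 iff it is
punctually N-1 at every point and only finitely many points fail to be punctually
normal. -/
theorem stmt15 (R : Type) [CommRing R] [IsDomain R] [IsNoetherianRing R] :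
    Module.Finite R (integralClosure R (FractionRing R)) ↔
      ((∀ p : PrimeSpectrum R, PunctuallyN1 (Localization.AtPrime p.asIdeal)) ∧
        {p : PrimeSpectrum R | ¬ PunctuallyNormal (Localization.AtPrime p.asIdeal)}.Finite) := by
  let N := {p : PrimeSpectrum R | ¬ PunctuallyNormal (Localization.AtPrime p.asIdeal)}
  have hfin : Module.Finite R (integralClosure R (FractionRing R)) ↔
      ∃ c : R, c ≠ 0 ∧ ∀ x : FractionRing R, IsIntegral R x →
        ∃ a : R, algebraMap R (FractionRing R) a = c • x :=
    finite_iff_exists_common_denominator (integralClosure R (FractionRing R)).toSubmodule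
  rw [hfin]
  constructor
  · rintro ⟨c, hc, hcx⟩
    refine ⟨fun p ↦ ?_, (finite_minimalPrimes_denominatorIdeal
      (K := FractionRing R) hc).subset fun p hp ↦ ?_⟩
    · have : IsNoetherianRing (Localization.AtPrime p.asIdeal) :=
        IsLocalization.isNoetherianRing p.asIdeal.primeCompl _ inferInstance
      refine (punctuallyN1_iff (FractionRing R)).2
        ⟨integralClosure (Localization.AtPrime p.asIdeal) (FractionRing R), ?_, fun x hx ↦ hx.1⟩
      refine (finite_iff_exists_common_denominator
        (integralClosure (Localization.AtPrime p.asIdeal) (FractionRing R)).toSubmodule).2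
        ⟨algebraMap R _ c, ?_, fun x hx ↦ ?_⟩
      · exact (map_ne_zero_iff _ (FaithfulSMul.algebraMap_injective R _)).2 hc
      · obtain ⟨s, hs⟩ := IsIntegral.exists_multiple_integral_of_isLocalization
          p.asIdeal.primeCompl x hx
        obtain ⟨a, ha⟩ := hcx _ hs
        rw [algebraMap_smul, exists_algebraMap_localization_eq_iff p.asIdeal]
        refine fun hle ↦ s.2 (hle (mem_denominatorIdeal.2 ⟨a, ?_⟩))
        rw [ha, smul_comm]
        rfl
    · rw [Set.mem_ofPred_eq, punctuallyNormal_localization_iff] at hp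
      push Not at hp
      obtain ⟨x, hx, hmin⟩ := hp
      exact ⟨x, hcx x hx, hmin⟩
  · rintro ⟨hN1, hN⟩
    have hloc : ∀ p ∈ N, ∃ c : R, c ≠ 0 ∧ ∀ x : FractionRing R, IsIntegral R x →
        ¬ denominatorIdeal R (c • x) ≤ p.asIdeal := by
      intro p hp
      refine (hN.wellFoundedOn (r := (· < ·))).induction
        (P := fun p ↦ ∃ c : R, c ≠ 0 ∧ ∀ x : FractionRing R, IsIntegral R x →
          ¬ denominatorIdeal R (c • x) ≤ p.asIdeal) hp fun p hp ih ↦ ?_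
      obtain ⟨c, hc, hcx⟩ := exists_smul_of_finite (hN.subset (Set.sep_subset N (· < p)))
        fun q hq ↦ ih q hq.1 hq.2
      obtain ⟨d, hd, hdx⟩ := (hN1 p).exists_smul
      refine ⟨d * c, mul_ne_zero hd hc, fun x hx ↦ ?_⟩
      rw [mul_smul]
      refine hdx _ (hx.smul c) fun q hqp hle ↦ ?_
      obtain ⟨q', hq', hq'N, hle'⟩ := exists_not_punctuallyNormal_le (hx.smul c) hle
      exact hcx x hx q' ⟨hq'N, hq'.trans_lt hqp⟩ hle'
    obtain ⟨c, hc, hcx⟩ := exists_smul_of_finite hN hloc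
    refine ⟨c, hc, fun x hx ↦ mem_range_of_forall_not_denominatorIdeal_le fun p hle ↦ ?_⟩
    obtain ⟨q, -, hqN, hle'⟩ := exists_not_punctuallyNormal_le (hx.smul c) hle
    exact hcx x hx q hqN hle'
end

section
/- Let (R, m) be a Noetherian local ring with I-adic completion R̂ along m. Then the pair (m, Spec R) is normal (every finite modification of Spec R centered at the closed point is an isomorphism) if and only if the pair (m̂, Spec R̂) is normal. -/
/-- The pair (V(I), Spec R) is normal: every finite modification centered at V(I) is an
isomorphism. -/
def IsNormalPair (R : Type) [CommRing R] (I : Ideal R) : Prop :=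
  ∀ (S : Type) (_ : CommRing S) (φ : R →+* S),
    (letI := φ.toAlgebra; Module.Finite R S) →
    (∃ n : ℕ,
      (∀ x ∈ RingHom.ker φ, ∀ y ∈ I ^ n, y * x = 0) ∧
      (∀ s : S, ∀ y ∈ I ^ n, φ y * s ∈ φ.range)) →
    (∀ q ∈ associatedPrimes S S, ¬ Ideal.map φ I ≤ q) →
    Function.Bijective φ

section Torsion

variable {A T : Type*} [CommRing A] [CommRing T] {I : Ideal A} {φ : A →+* T}

lemma eq_zero_of_pow_mul_eq_zero (h : ∀ s : T, (∀ y ∈ I, φ y * s = 0) → s = 0) (k : ℕ) :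
    ∀ s : T, (∀ y ∈ I ^ k, φ y * s = 0) → s = 0 := by
  induction k with
  | zero => intro s hs; simpa using hs 1 (by simp)
  | succ k ih =>
    refine fun s hs ↦ ih s fun y hy ↦ h _ fun z hz ↦ ?_
    rw [← mul_assoc, ← map_mul]
    exact hs _ (by rw [pow_succ']; exact Ideal.mul_mem_mul hz hy)

lemma not_map_le_of_mem_associatedPrimes (hI : I.FG)
    (h : ∀ s : T, (∀ y ∈ I, φ y * s = 0) → s = 0) :
    ∀ q ∈ associatedPrimes T T, ¬ Ideal.map φ I ≤ q := by
  intro q hq hle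
  obtain ⟨hprime, x, rfl⟩ := hq
  obtain ⟨k, hk⟩ := Ideal.exists_pow_le_of_le_radical_of_fg hle (hI.map φ)
  have hx : x = 0 := eq_zero_of_pow_mul_eq_zero h k x fun y hy ↦ by
    have := hk (by rw [← Ideal.map_pow]; exact Ideal.mem_map_of_mem φ hy)
    simpa [Submodule.mem_colon_singleton] using this
  apply hprime.ne_top
  rw [Ideal.radical_eq_top, Ideal.eq_top_iff_one]
  simp [Submodule.mem_colon_singleton, hx]

lemma isNoetherianRing_quotient_of_map_le [IsNoetherianRing (A ⧸ I)] (hφ : φ.Finite)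
    {J : Ideal T} (hJ : Ideal.map φ I ≤ J) : IsNoetherianRing (T ⧸ J) := by
  let ψ : A ⧸ I →+* T ⧸ J := Ideal.quotientMap J φ (Ideal.map_le_iff_le_comap.mp hJ)
  have hψ : ψ.Finite := by
    apply RingHom.Finite.of_comp_finite (f := Ideal.Quotient.mk I)
    rw [Ideal.quotientMap_comp_mk]
    exact (RingHom.Finite.of_surjective _ Ideal.Quotient.mk_surjective).comp hφ
  let := ψ.toAlgebra
  have : Module.Finite (A ⧸ I) (T ⧸ J) := hψ
  exact IsNoetherianRing.of_finite (A ⧸ I) (T ⧸ J)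

lemma eq_zero_of_not_map_le [IsNoetherianRing (A ⧸ I)] (hφ : φ.Finite)
    (h : ∀ q ∈ associatedPrimes T T, ¬ Ideal.map φ I ≤ q) (s : T)
    (hs : ∀ y ∈ I, φ y * s = 0) : s = 0 := by
  by_contra hs0
  let J : Ideal T := (⊥ : Submodule T T).colon {s}
  have memJ (t : T) : t ∈ J ↔ t * s = 0 := by simp [J, Submodule.mem_colon_singleton]
  have hIJ : Ideal.map φ I ≤ J := Ideal.map_le_iff_le_comap.mpr fun y hy ↦ (memJ _).mpr (hs y hy)
  have := isNoetherianRing_quotient_of_map_le hφ hIJ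
  have : Nontrivial (T ⧸ J) := Ideal.Quotient.nontrivial_iff.mpr fun htop ↦ hs0 <| by
    simpa using (memJ 1).mp (htop ▸ Submodule.mem_top)
  obtain ⟨P, hP, -⟩ := exists_le_isAssociatedPrime_of_isNoetherianRing (T ⧸ J) (1 : T ⧸ J)
    one_ne_zero
  obtain ⟨hprime, x, hx⟩ := hP
  obtain ⟨u, rfl⟩ := Ideal.Quotient.mk_surjective x
  have hcomap : P.comap (Ideal.Quotient.mk J) = ((⊥ : Submodule T T).colon {u * s}).radical := by
    ext t
    rw [hx, Ideal.comap_radical]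
    congr! 2
    ext t
    simp [Submodule.mem_colon_singleton, ← map_mul, Ideal.Quotient.eq_zero_iff_mem, memJ,
      mul_assoc]
  refine h (P.comap (Ideal.Quotient.mk J)) ⟨hprime.comap _, u * s, hcomap⟩ (hIJ.trans ?_)
  intro t ht
  simp [Ideal.mem_comap, Ideal.Quotient.eq_zero_iff_mem.mpr ht]

end Torsion

section Flat

open TensorProduct

variable {R A M : Type*} [CommRing R] [CommRing A] [Algebra R A] [AddCommGroup M] [Module R M]

lemma mem_range_lTensor_torsionBySet [Module.Flat R A] {J : Ideal R} (hJ : J.FG) (z : A ⊗[R] M)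
    (hz : ∀ y ∈ J, y • z = 0) :
    z ∈ LinearMap.range ((Submodule.torsionBySet R M (J : Set R)).subtype.lTensor A) := by
  classical
  obtain ⟨s, rfl⟩ := hJ
  let g : M →ₗ[R] (s → M) := LinearMap.pi fun i ↦ (i : R) • LinearMap.id
  have hexact : Function.Exact
      (Submodule.torsionBySet R M ((Ideal.span (s : Set R) : Ideal R) : Set R)).subtype g := by
    intro x
    rw [← Submodule.torsionBySet_eq_torsionBySet_span]
    simp [g, funext_iff, Submodule.mem_torsionBySet_iff]
  refine (Module.Flat.lTensor_exact A hexact z).mp ?_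
  apply (TensorProduct.piRight R R A (fun _ : s ↦ M)).injective
  rw [map_zero]
  ext i
  have key (w : A ⊗[R] M) :
      TensorProduct.piRight R R A (fun _ : s ↦ M) (g.lTensor A w) i = (i : R) • w := by
    induction w with
    | zero => simp
    | tmul a m => simp [g]
    | add a b ha hb => simp only [map_add, Pi.add_apply, ha, hb, smul_add]
  rw [key]
  exact hz _ (Ideal.subset_span i.2)

lemma tensor_eq_zero_of_smul_eq_zero [Module.Flat R A] {J : Ideal R} (hJ : J.FG)
    (hM : ∀ x : M, (∀ y ∈ J, y • x = 0) → x = 0) (z : A ⊗[R] M)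
    (hz : ∀ y ∈ J, y • z = 0) : z = 0 := by
  obtain ⟨w, rfl⟩ := mem_range_lTensor_torsionBySet hJ z hz
  have hbot : (Submodule.torsionBySet R M (J : Set R)).subtype = 0 := by
    ext x
    exact hM x fun y hy ↦ (Submodule.mem_torsionBySet_iff _ _).mp x.2 ⟨y, hy⟩
  simp [hbot]

lemma exists_sub_algebraMap_mem_pow {I : Ideal R}
    (hsurj : ∀ a : A, ∃ r : R, a - algebraMap R A r ∈ I.map (algebraMap R A)) (n : ℕ) :
    ∀ a : A, ∃ r : R, a - algebraMap R A r ∈ (I ^ n).map (algebraMap R A) := by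
  induction n with
  | zero => intro a; exact ⟨0, by simp [Ideal.map_top]⟩
  | succ n ih =>
    have key : ∀ b ∈ (I ^ n).map (algebraMap R A),
        ∃ r : R, b - algebraMap R A r ∈ (I ^ (n + 1)).map (algebraMap R A) := by
      intro b hb
      induction hb using Submodule.span_induction with
      | mem x hx => obtain ⟨y, -, rfl⟩ := hx; exact ⟨y, by simp⟩
      | zero => exact ⟨0, by simp⟩
      | add x y _ _ hx hy =>
        obtain ⟨r, hr⟩ := hx
        obtain ⟨s, hs⟩ := hy
        exact ⟨r + s, by rw [map_add, add_sub_add_comm]; exact add_mem hr hs⟩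
      | smul c x hx' hx =>
        obtain ⟨r, hr⟩ := hsurj c
        obtain ⟨s, hs⟩ := hx
        refine ⟨r * s, ?_⟩
        have heq : c • x - algebraMap R A (r * s) =
            (c - algebraMap R A r) * x + algebraMap R A r * (x - algebraMap R A s) := by
          rw [map_mul, smul_eq_mul]; ring
        rw [heq]
        refine add_mem ?_ (Ideal.mul_mem_left _ _ hs)
        rw [pow_succ', Ideal.map_mul]
        exact Ideal.mul_mem_mul hr hx'
    intro a
    obtain ⟨r, hr⟩ := ih a
    obtain ⟨s, hs⟩ := key _ hr
    exact ⟨r + s, by rwa [map_add, ← sub_sub]⟩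

lemma exists_one_tmul_eq [Module.Flat R A] {J : Ideal R} (hJ : J.FG)
    (hsurj : ∀ a : A, ∃ r : R, a - algebraMap R A r ∈ J.map (algebraMap R A)) (z : A ⊗[R] M)
    (hz : ∀ y ∈ J, y • z = 0) : ∃ x : M, z = 1 ⊗ₜ x := by
  obtain ⟨w, rfl⟩ := mem_range_lTensor_torsionBySet hJ z hz
  clear hz
  induction w with
  | zero => exact ⟨0, by simp⟩
  | add v w hv hw =>
    obtain ⟨x, hx⟩ := hv
    obtain ⟨y, hy⟩ := hw
    exact ⟨x + y, by rw [map_add, hx, hy, tmul_add]⟩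
  | tmul a x =>
    obtain ⟨r, hr⟩ := hsurj a
    have hzero : ∀ c ∈ J.map (algebraMap R A), c ⊗ₜ[R] (x : M) = 0 := by
      intro c hc
      induction hc using Submodule.span_induction with
      | mem c hc =>
        obtain ⟨y, hy, rfl⟩ := hc
        have hyx : y • (x : M) = 0 := (Submodule.mem_torsionBySet_iff _ _).mp x.2 ⟨y, hy⟩
        rw [Algebra.algebraMap_eq_smul_one, smul_tmul, hyx, tmul_zero]
      | zero => simp
      | add b c _ _ hb hc => rw [add_tmul, hb, hc, add_zero]
      | smul b c _ hc =>
        have := congrArg (b • ·) hc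
        simpa [smul_tmul'] using this
    refine ⟨r • x, ?_⟩
    have := hzero _ hr
    rw [sub_tmul, sub_eq_zero, Algebra.algebraMap_eq_smul_one, smul_tmul] at this
    simpa using this

lemma exists_sub_algebraMap_mem_of_mul_mem [Module.Flat R A] {J : Ideal R} (hJ : J.FG)
    (hsurj : ∀ a : A, ∃ r : R, a - algebraMap R A r ∈ J.map (algebraMap R A)) (K : Ideal R) (a : A)
    (ha : ∀ y ∈ J, algebraMap R A y * a ∈ K.map (algebraMap R A)) :
    ∃ r : R, a - algebraMap R A r ∈ K.map (algebraMap R A) := by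
  let e := TensorProduct.tensorQuotEquivQuotSMul A K
  have mem (b : A) : b ∈ K.map (algebraMap R A) ↔ b ⊗ₜ[R] (1 : R ⧸ K) = 0 := by
    rw [← e.map_eq_zero_iff, ← Submodule.restrictScalars_mem R, ← Ideal.smul_top_eq_map,
      ← Submodule.Quotient.mk_eq_zero, ← map_one (Ideal.Quotient.mk K),
      TensorProduct.tensorQuotEquivQuotSMul_tmul_mk, one_smul]
  obtain ⟨x, hx⟩ := exists_one_tmul_eq hJ hsurj (a ⊗ₜ[R] (1 : R ⧸ K)) fun y hy ↦ by
    rw [smul_tmul', ← mem, Algebra.smul_def]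
    exact ha y hy
  obtain ⟨r, rfl⟩ := Ideal.Quotient.mk_surjective x
  refine ⟨r, (mem _).mpr ?_⟩
  rw [sub_tmul, hx, sub_eq_zero, Algebra.algebraMap_eq_smul_one, smul_tmul]
  congr 1
  rw [Algebra.smul_def, mul_one]
  rfl

lemma eq_zero_of_algebraMap_mul_eq_zero [Module.Flat R A] {J : Ideal R} (hJ : J.FG)
    (hR : ∀ x : R, (∀ y ∈ J, y * x = 0) → x = 0) (a : A)
    (ha : ∀ y ∈ J, algebraMap R A y * a = 0) : a = 0 := by
  rw [← (TensorProduct.rid R A).symm.map_eq_zero_iff]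
  refine tensor_eq_zero_of_smul_eq_zero hJ hR _ fun y hy ↦ ?_
  rw [← map_smul, Algebra.smul_def, ha y hy, map_zero]

end Flat

section NormalPair

variable {R : Type} [CommRing R] {I : Ideal R}

lemma IsNormalPair.eq_zero_of_mul_eq_zero [IsNoetherianRing R] (h : IsNormalPair R I) (x : R)
    (hx : ∀ y ∈ I, y * x = 0) : x = 0 := by
  let J : ℕ →o Ideal R :=
    ⟨fun k ↦ Submodule.torsionBySet R R ((I ^ k : Ideal R) : Set R), fun k l hkl ↦
      Submodule.torsionBySet_le_torsionBySet_of_subset (Ideal.pow_le_pow_right hkl)⟩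
  have memJ (k : ℕ) (x : R) : x ∈ J k ↔ ∀ y ∈ I ^ k, y * x = 0 := by
    exact (Submodule.mem_torsionBySet_iff _ _).trans Subtype.forall
  obtain ⟨n, hn⟩ := monotone_stabilizes_iff_noetherian.mpr ‹IsNoetherianRing R› J
  have hbij := h (R ⧸ J n) inferInstance (Ideal.Quotient.mk (J n))
    (RingHom.Finite.of_surjective _ Ideal.Quotient.mk_surjective)
    ⟨n, fun x hx ↦ (memJ n x).mp (by simpa [Ideal.mk_ker] using hx),
      fun s y _ ↦ Ideal.Quotient.mk_surjective _⟩
    (not_map_le_of_mem_associatedPrimes (IsNoetherian.noetherian I) fun s hs ↦ by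
      obtain ⟨x, rfl⟩ := Ideal.Quotient.mk_surjective s
      rw [Ideal.Quotient.eq_zero_iff_mem, hn (n + 1) n.le_succ, memJ]
      intro y hy
      rw [pow_succ] at hy
      induction hy using Submodule.mul_induction_on' with
      | mem_mul_mem a ha b hb =>
        have := hs b hb
        rw [← map_mul, Ideal.Quotient.eq_zero_iff_mem, memJ] at this
        rw [mul_assoc]
        exact this a ha
      | add a _ b _ ha hb => rw [add_mul, ha, hb, add_zero])
  apply hbij.1
  rw [map_zero, Ideal.Quotient.eq_zero_iff_mem]
  have h1 : x ∈ J (n + 1) := J.monotone (Nat.le_add_left 1 n) ((memJ 1 x).mpr (by simpa using hx))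
  rwa [← hn (n + 1) n.le_succ] at h1

lemma exists_mem_nonZeroDivisors_of_eq_zero [IsNoetherianRing R]
    (hR : ∀ x : R, (∀ y ∈ I, y * x = 0) → x = 0) : ∃ f ∈ I, f ∈ nonZeroDivisors R := by
  by_contra! hcon
  have hsub : (I : Set R) ⊆ ⋃ p ∈ associatedPrimes R R, (p : Set R) := by
    rw [biUnion_associatedPrimes_eq_compl_nonZeroDivisors]
    exact hcon
  obtain ⟨p, hp, hle⟩ := (I.subset_union_prime_finite (associatedPrimes.finite R R) (f := id) 0 0
    fun _ h _ _ ↦ h.1).1 hsub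
  refine not_map_le_of_mem_associatedPrimes (φ := RingHom.id R) (IsNoetherian.noetherian I)
    (by simpa using hR) p hp ?_
  simpa using hle

variable {A : Type} [CommRing A] [Algebra R A]

open TensorProduct in
lemma IsNormalPair.of_faithfullyFlat [IsNoetherianRing R] [Module.FaithfullyFlat R A]
    (h : IsNormalPair A (I.map (algebraMap R A))) : IsNormalPair R I := by
  intro S _ φ hfin ⟨n, hker, hcok⟩ hass
  have hI : I.FG := IsNoetherian.noetherian I
  have hS := eq_zero_of_not_map_le (φ := φ) hfin hass
  let := φ.toAlgebra
  have : Module.Finite R S := hfin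
  have hexact : Function.Exact (LinearMap.ker (Algebra.linearMap R S)).subtype
      (Algebra.linearMap R S) := LinearMap.exact_subtype_ker_map _
  have hkerA : ∀ x ∈ RingHom.ker (algebraMap A (A ⊗[R] S)), ∀ y ∈ I ^ n,
      algebraMap R A y * x = 0 := by
    intro x hx y hy
    have hx' : x ⊗ₜ[R] (1 : S) = 0 := hx
    have hx'' : (Algebra.linearMap R S).lTensor A (x ⊗ₜ[R] (1 : R)) = 0 := by simpa using hx'
    obtain ⟨w, hw⟩ := (Module.Flat.lTensor_exact A hexact _).mp hx''
    have hzero : y • w = 0 := by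
      clear hw
      induction w with
      | zero => simp
      | add v w hv hw => rw [smul_add, hv, hw, add_zero]
      | tmul a k =>
        have : y • k = 0 := Subtype.ext (hker k k.2 y hy)
        rw [← tmul_smul, this, tmul_zero]
    have hyx : y • (x ⊗ₜ[R] (1 : R)) = 0 := by rw [← hw, ← map_smul, hzero, map_zero]
    have := congrArg (TensorProduct.rid R A) hyx
    simpa [Algebra.smul_def] using this
  have hcokA : ∀ s : A ⊗[R] S, ∀ y ∈ I ^ n, y • s ∈ (algebraMap A (A ⊗[R] S)).range := by
    intro s y hy
    induction s with
    | zero => rw [smul_zero]; exact zero_mem _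
    | add s t hs ht => rw [smul_add]; exact add_mem hs ht
    | tmul a s =>
      obtain ⟨r, hr⟩ := hcok s y hy
      refine ⟨r • a, ?_⟩
      have hys : y • s = r • (1 : S) := by
        rw [Algebra.smul_def, Algebra.smul_def, mul_one]; exact hr.symm
      rw [← tmul_smul, hys, tmul_smul, smul_tmul']
      rfl
  have hbij := h (A ⊗[R] S) inferInstance (algebraMap A (A ⊗[R] S))
    (RingHom.finite_algebraMap.mpr inferInstance)
    ⟨n, fun x hx y hy ↦ by
      rw [← Ideal.map_pow] at hy
      induction hy using Submodule.span_induction with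
      | mem y hy => obtain ⟨y, hy, rfl⟩ := hy; exact hkerA x hx y hy
      | zero => simp
      | add a b _ _ ha hb => rw [add_mul, ha, hb, add_zero]
      | smul a b _ hb => rw [smul_mul_assoc, hb, smul_zero],
    fun s y hy ↦ by
      rw [← Ideal.map_pow] at hy
      induction hy using Submodule.span_induction with
      | mem y hy =>
        obtain ⟨y, hy, rfl⟩ := hy
        rw [← Algebra.smul_def, algebraMap_smul]
        exact hcokA s y hy
      | zero => simp
      | add a b _ _ ha hb => rw [map_add, add_mul]; exact add_mem ha hb
      | smul a b _ hb => rw [smul_eq_mul, map_mul, mul_assoc]; exact mul_mem ⟨a, rfl⟩ hb⟩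
    (not_map_le_of_mem_associatedPrimes (hI.map _) fun s hs ↦
      tensor_eq_zero_of_smul_eq_zero hI
        (fun x hx ↦ hS x fun y hy ↦ (Algebra.smul_def y x).symm.trans (hx y hy)) s fun y hy ↦ by
          rw [← algebraMap_smul A, Algebra.smul_def]
          exact hs _ (Ideal.mem_map_of_mem _ hy))
  have hcomp : ⇑((Algebra.linearMap R S).lTensor A) =
      algebraMap A (A ⊗[R] S) ∘ TensorProduct.rid R A := by
    ext z
    induction z with
    | zero => simp
    | add z w hz hw => simp only [map_add, hz, hw, Function.comp_apply]
    | tmul a r =>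
      change a ⊗ₜ[R] algebraMap R S r = (r • a) ⊗ₜ[R] (1 : S)
      rw [Algebra.algebraMap_eq_smul_one, tmul_smul, smul_tmul']
  refine (Module.FaithfullyFlat.lTensor_bijective_iff_bijective R A (Algebra.linearMap R S)).mp ?_
  rw [hcomp]
  exact hbij.comp (TensorProduct.rid R A).bijective

lemma exists_algebraMap_eq_of_algebraMap_mul_eq [Module.FaithfullyFlat R A] {g : R}
    (hg : ∀ a : A, algebraMap R A g * a = 0 → a = 0) {a : A} {r : R}
    (h : algebraMap R A g * a = algebraMap R A r) : ∃ r' : R, r = g * r' ∧ algebraMap R A r' = a := by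
  have hr : r ∈ Ideal.span {g} := by
    rw [← Ideal.comap_map_eq_self_of_faithfullyFlat (B := A) (Ideal.span {g}), Ideal.mem_comap, ← h]
    exact Ideal.mul_mem_right _ _ (Ideal.mem_map_of_mem _ (Ideal.mem_span_singleton_self g))
  obtain ⟨r', rfl⟩ := Ideal.mem_span_singleton'.mp hr
  refine ⟨r', mul_comm _ _, ?_⟩
  rw [← sub_eq_zero]
  apply hg
  rw [mul_sub, h, map_mul]
  ring

lemma IsNormalPair.map_of_faithfullyFlat [IsNoetherianRing R] [Module.FaithfullyFlat R A]
    (hsurj : ∀ a : A, ∃ r : R, a - algebraMap R A r ∈ I.map (algebraMap R A))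
    (h : IsNormalPair R I) : IsNormalPair A (I.map (algebraMap R A)) := by
  intro T _ φ hfin ⟨n, hker, hcok⟩ hass
  have hI : I.FG := IsNoetherian.noetherian I
  have : IsNoetherianRing (A ⧸ I.map (algebraMap R A)) := by
    refine isNoetherianRing_of_surjective R _
      ((Ideal.Quotient.mk (I.map (algebraMap R A))).comp (algebraMap R A)) fun x ↦ ?_
    obtain ⟨a, rfl⟩ := Ideal.Quotient.mk_surjective x
    obtain ⟨r, hr⟩ := hsurj a
    exact ⟨r, ((Ideal.Quotient.mk_eq_mk_iff_sub_mem _ _).mpr hr).symm⟩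
  have hT := eq_zero_of_not_map_le (φ := φ) hfin hass
  have hR := h.eq_zero_of_mul_eq_zero
  have hA : ∀ a : A, (∀ y ∈ I.map (algebraMap R A), y * a = 0) → a = 0 := fun a ha ↦
    eq_zero_of_algebraMap_mul_eq_zero hI hR a fun y hy ↦ ha _ (Ideal.mem_map_of_mem _ hy)
  have hinj : Function.Injective φ := by
    rw [injective_iff_map_eq_zero]
    exact fun a ha ↦ eq_zero_of_pow_mul_eq_zero (φ := RingHom.id A) hA n a (hker a ha)
  obtain ⟨f, hfI, hf⟩ := exists_mem_nonZeroDivisors_of_eq_zero hR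
  set g : R := f ^ n with hg
  have hgI : g ∈ I ^ n := Ideal.pow_mem_pow hfI n
  have hgR : g ∈ nonZeroDivisors R := pow_mem hf n
  have hgA : ∀ a : A, algebraMap R A g * a = 0 → a = 0 := fun a ha ↦
    eq_zero_of_algebraMap_mul_eq_zero (Submodule.fg_span_singleton g)
      (fun x hx ↦ (mem_nonZeroDivisors_iff.mp hgR).1 x
        (hx g (Ideal.mem_span_singleton_self g))) a fun y hy ↦ by
          obtain ⟨c, rfl⟩ := Ideal.mem_span_singleton'.mp hy
          rw [map_mul, mul_assoc, ha, mul_zero]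
  have hmapI : ∀ y ∈ I ^ n, algebraMap R A y ∈ I.map (algebraMap R A) ^ n := fun y hy ↦ by
    rw [← Ideal.map_pow]; exact Ideal.mem_map_of_mem _ hy
  let := (φ.comp (algebraMap R A)).toAlgebra
  have hι (r : R) : algebraMap R T r = φ (algebraMap R A r) := rfl
  have hgT : ∀ t : T, algebraMap R T g * t = 0 → t = 0 := by
    intro t ht
    refine eq_zero_of_pow_mul_eq_zero hT n t fun y hy ↦ ?_
    obtain ⟨a, ha⟩ := hcok t y hy
    rw [← ha, hgA a, map_zero]
    apply hinj
    rw [map_mul, ha, ← hι, mul_left_comm, ht, mul_zero, map_zero]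
  let S : Subalgebra R T :=
    { carrier := {t | ∃ r : R, algebraMap R T g * t = algebraMap R T r}
      add_mem' := by
        rintro s t ⟨a, ha⟩ ⟨b, hb⟩
        exact ⟨a + b, by rw [mul_add, ha, hb, map_add]⟩
      mul_mem' := by
        rintro s t ⟨a, ha⟩ ⟨b, hb⟩
        obtain ⟨c, hc⟩ := hcok (s * t) _ (hmapI g hgI)
        have hcab : algebraMap R A g * c = algebraMap R A (a * b) := by
          apply hinj
          rw [map_mul, hc, ← hι, ← hι, map_mul, ← ha, ← hb]
          ring
        obtain ⟨d, -, rfl⟩ := exists_algebraMap_eq_of_algebraMap_mul_eq hgA hcab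
        exact ⟨d, hc.symm⟩
      algebraMap_mem' := fun r ↦ ⟨g * r, (map_mul _ _ _).symm⟩ }
  have memS (t : T) : t ∈ S ↔ ∃ r : R, algebraMap R T g * t = algebraMap R T r := Iff.rfl
  have hSA (a : A) (ha : φ a ∈ S) : ∃ r : R, algebraMap R A r = a := by
    obtain ⟨r, hr⟩ := ha
    have : algebraMap R A g * a = algebraMap R A r := by
      apply hinj; rw [map_mul]; exact hr
    obtain ⟨r', -, h'⟩ := exists_algebraMap_eq_of_algebraMap_mul_eq hgA this
    exact ⟨r', h'⟩
  have hSfin : Module.Finite R S := by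
    let μ : S →ₗ[R] LinearMap.range (Algebra.linearMap R T) :=
      ((LinearMap.mulLeft R (algebraMap R T g)).comp S.val.toLinearMap).codRestrict _ fun s ↦ by
        obtain ⟨r, hr⟩ := s.2
        exact ⟨r, hr.symm⟩
    refine Module.Finite.of_injective μ ((injective_iff_map_eq_zero μ).mpr fun s hs ↦ ?_)
    exact Subtype.ext (hgT s (congrArg Subtype.val hs))
  have hbij := h S inferInstance (algebraMap R S) (RingHom.finite_algebraMap.mpr hSfin)
    ⟨n, fun x hx y _ ↦ by
      have hx0 : φ (algebraMap R A x) = 0 := congrArg Subtype.val (RingHom.mem_ker.mp hx)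
      have : x = 0 := by
        apply FaithfulSMul.algebraMap_injective R A
        apply hinj
        rw [hx0, map_zero, map_zero]
      rw [this, mul_zero],
    fun s y hy ↦ by
      obtain ⟨a, ha⟩ := hcok s _ (hmapI y hy)
      obtain ⟨r, rfl⟩ := hSA a (ha ▸ mul_mem (S.algebraMap_mem y) s.2)
      exact ⟨r, Subtype.ext ha⟩⟩
    (not_map_le_of_mem_associatedPrimes hI fun s hs ↦ Subtype.ext <| hT s fun y hy ↦ by
      induction hy using Submodule.span_induction with
      | mem y hy => obtain ⟨y, hy, rfl⟩ := hy; exact congrArg Subtype.val (hs y hy)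
      | zero => simp
      | add a b _ _ ha hb => rw [map_add, add_mul, ha, hb, add_zero]
      | smul a b _ hb => rw [smul_eq_mul, map_mul, mul_assoc, hb, mul_zero])
  refine ⟨hinj, fun t ↦ ?_⟩
  obtain ⟨a, ha⟩ := hcok t _ (hmapI g hgI)
  obtain ⟨r, hr⟩ := exists_sub_algebraMap_mem_of_mul_mem (hI.pow (n := n))
    (exists_sub_algebraMap_mem_pow hsurj n) (Ideal.span {g}) a fun y hy ↦ by
      obtain ⟨b, hb⟩ := hcok t _ (hmapI y hy)
      have : algebraMap R A y * a = algebraMap R A g * b := by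
        apply hinj
        rw [map_mul, map_mul, ha, hb]
        ring
      rw [this]
      exact Ideal.mul_mem_right _ _ (Ideal.mem_map_of_mem _ (Ideal.mem_span_singleton_self g))
  rw [Ideal.map_span, Set.image_singleton, Ideal.mem_span_singleton'] at hr
  obtain ⟨b, hb⟩ := hr
  have htb : t - φ b ∈ S := ⟨r, by
    rw [mul_sub, hι, ← ha, ← map_mul, ← map_sub, mul_comm _ b, hb, sub_sub_cancel, ← hι]⟩
  obtain ⟨r', hr'⟩ := hbij.2 ⟨_, htb⟩
  refine ⟨algebraMap R A r' + b, ?_⟩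
  rw [map_add]
  exact eq_sub_iff_add_eq.mp (congrArg Subtype.val hr')

end NormalPair

/-- For a Noetherian local ring (R,m) with m-adic completion R̂, the pair
(m, Spec R) is normal iff the pair (m̂, Spec R̂) is normal. -/
theorem stmt18 (R : Type) [CommRing R] [IsLocalRing R] [IsNoetherianRing R] :
    IsNormalPair R (IsLocalRing.maximalIdeal R) ↔
      IsNormalPair (AdicCompletion (IsLocalRing.maximalIdeal R) R)
        (Ideal.map (algebraMap R (AdicCompletion (IsLocalRing.maximalIdeal R) R))
          (IsLocalRing.maximalIdeal R)) := by
  have : Module.FaithfullyFlat R (AdicCompletion (IsLocalRing.maximalIdeal R) R) :=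
    Module.FaithfullyFlat.of_flat_of_isLocalHom
  refine ⟨IsNormalPair.map_of_faithfullyFlat fun a ↦ ?_, IsNormalPair.of_faithfullyFlat⟩
  obtain ⟨r, hr⟩ := Ideal.Quotient.mk_surjective
    (AdicCompletion.evalOneₐ (IsLocalRing.maximalIdeal R) a)
  refine ⟨r, ?_⟩
  rw [← AdicCompletion.ker_evalOneₐ_eq_map _ (IsNoetherian.noetherian _), RingHom.mem_ker]
  simp only [AlgHom.toRingHom_eq_coe, RingHom.coe_coe, map_sub, AlgHom.commutes]
  rw [← hr]
  exact sub_self _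
end
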